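/- arXiv:2001.07318 — 5 statements merged into one kernel-verified Lean document; each statement's English description precedes it below -/
import Mathlib

section
/- Let θ be a base flow on a metric space P and let φ be a cocycle semiflow on a metric space X over θ. For a nonautonomous set B(·) in X, define B̃(p) := closure(⋃_{s≥0} φ(s, θ_{-s}p)B(θ_{-s}p)) for each p ∈ P. Then the pullback omega-limit sets of B̃(·) and of B(·) coincide: ω(B̃)(p) = ω(B)(p) for every p ∈ P. -/
open Set Filter Metric

/-- The pullback omega-limit set of a nonautonomous set `B(·)` under the cocycle
semiflow `φ` over the base flow `θ`:
`ω(B)(p) = ⋂_{T ≥ 0} closure (⋃_{t ≥ T} φ(t, θ_{-t}p) B(θ_{-t}p))`. -/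
def pullbackOmegaLimit {P X : Type*} [TopologicalSpace X]
    (θ : ℝ → P → P) (φ : ℝ → P → X → X) (B : P → Set X) (p : P) : Set X :=
  ⋂ T ∈ Ici (0 : ℝ), closure (⋃ t ∈ Ici T, φ t (θ (-t) p) '' B (θ (-t) p))

theorem pullback_omega_limit_of_hull_eq
    {P X : Type*} [MetricSpace P] [MetricSpace X]
    (θ : ℝ → P → P) (φ : ℝ → P → X → X)
    -- θ is a base flow on P
    (hθcont : Continuous fun q : ℝ × P => θ q.1 q.2)
    (hθ0 : ∀ p, θ 0 p = p)
    (hθadd : ∀ t s : ℝ, ∀ p, θ (t + s) p = θ t (θ s p))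
    -- φ is a cocycle semiflow on X over θ
    (hφcont : ContinuousOn (fun q : ℝ × P × X => φ q.1 q.2.1 q.2.2) {q | 0 ≤ q.1})
    (hφ0 : ∀ p x, φ 0 p x = x)
    (hφcoc : ∀ t s : ℝ, 0 ≤ t → 0 ≤ s → ∀ p x, φ (t + s) p x = φ t (θ s p) (φ s p x))
    -- a nonautonomous set and its pullback hull B̃
    (B : P → Set X)
    (Btilde : P → Set X)
    (hBtilde : ∀ p, Btilde p = closure (⋃ s ∈ Ici (0 : ℝ), φ s (θ (-s) p) '' B (θ (-s) p))) :
    ∀ p : P, pullbackOmegaLimit θ φ Btilde p = pullbackOmegaLimit θ φ B p := by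
  intro p
  unfold pullbackOmegaLimit
  apply Subset.antisymm
  · refine iInter₂_mono fun T hT => ?_
    refine closure_minimal ?_ isClosed_closure
    refine iUnion₂_subset fun t ht => ?_
    have ht0 : (0 : ℝ) ≤ t := le_trans hT ht
    have hc : Continuous (φ t (θ (-t) p)) := by
      have h1 : Continuous fun x : X => ((t, θ (-t) p, x) : ℝ × P × X) := by fun_prop
      exact hφcont.comp_continuous h1 (fun _ => ht0)
    rw [hBtilde]
    refine (image_closure_subset_closure_image hc).trans (closure_mono ?_)
    rintro _ ⟨y, hy, rfl⟩
    simp only [mem_iUnion] at hy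
    obtain ⟨s, hs, b, hb, rfl⟩ := hy
    have hs0 : (0 : ℝ) ≤ s := hs
    have e1 : θ (-s) (θ (-t) p) = θ (-(t + s)) p := by
      rw [← hθadd]; congr 1; ring
    have e2 : θ s (θ (-(t + s)) p) = θ (-t) p := by
      rw [← hθadd]; congr 1; ring
    have hTs : T ≤ t + s := le_trans ht (by linarith)
    rw [e1] at hb
    refine mem_iUnion₂.2 ⟨t + s, hTs, b, hb, ?_⟩
    rw [hφcoc t s ht0 hs0, e2, e1]
  · refine iInter₂_mono fun T hT => closure_mono ?_
    refine iUnion₂_mono fun t ht => image_mono ?_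
    intro b hb
    rw [hBtilde]
    refine subset_closure (mem_iUnion₂.2 ⟨0, self_mem_Ici, b, ?_, hφ0 _ _⟩)
    rwa [neg_zero, hθ0]
end

section
/- Let θ be a base flow on a metric space P and let φ be a cocycle semiflow on a metric space X over θ. Let U(·) be a nonautonomous set in X that is forward invariant under φ and such that each section U(p) is nonempty and compact. Then for every p ∈ P the pullback omega-limit set ω(U)(p) is nonempty and compact, the family ω(U)(·) is invariant under φ (i.e. φ(t,p)ω(U)(p) = ω(U)(θ_t p) for all t ≥ 0, p ∈ P), and ω(U)(·) pullback attracts U(·). -/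
open Set Filter Metric

/-- `B(·)` is pullback attracted by `K(·)` under `φ`. -/
def PullbackAttracts {P X : Type*} [MetricSpace X]
    (θ : ℝ → P → P) (φ : ℝ → P → X → X) (K B : P → Set X) : Prop :=
  ∀ p : P, ∀ ε > (0 : ℝ), ∃ T : ℝ, ∀ t ≥ T, ∀ x ∈ B (θ (-t) p),
    Metric.infDist (φ t (θ (-t) p) x) (K p) < ε

theorem omega_limit_is_pullback_attractor_of_compact_forward_invariant
    {P X : Type*} [MetricSpace P] [MetricSpace X]
    (θ : ℝ → P → P) (φ : ℝ → P → X → X)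
    -- θ is a base flow on P
    (hθcont : Continuous fun q : ℝ × P => θ q.1 q.2)
    (hθ0 : ∀ p, θ 0 p = p)
    (hθadd : ∀ t s : ℝ, ∀ p, θ (t + s) p = θ t (θ s p))
    -- φ is a cocycle semiflow on X over θ
    (hφcont : ContinuousOn (fun q : ℝ × P × X => φ q.1 q.2.1 q.2.2) {q | 0 ≤ q.1})
    (hφ0 : ∀ p x, φ 0 p x = x)
    (hφcoc : ∀ t s : ℝ, 0 ≤ t → 0 ≤ s → ∀ p x, φ (t + s) p x = φ t (θ s p) (φ s p x))
    -- a forward invariant nonautonomous set U with nonempty compact sections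
    (U : P → Set X)
    (hUne : ∀ p, (U p).Nonempty) (hUcpt : ∀ p, IsCompact (U p))
    (hfwd : ∀ t : ℝ, 0 ≤ t → ∀ p : P, φ t p '' U p ⊆ U (θ t p)) :
    (∀ p : P, (pullbackOmegaLimit θ φ U p).Nonempty ∧ IsCompact (pullbackOmegaLimit θ φ U p)) ∧
      (∀ t : ℝ, 0 ≤ t → ∀ p : P,
        φ t p '' pullbackOmegaLimit θ φ U p = pullbackOmegaLimit θ φ U (θ t p)) ∧
      PullbackAttracts θ φ (pullbackOmegaLimit θ φ U) U := by
  have hθθ : ∀ a b c : ℝ, a + b = c → ∀ p, θ a (θ b p) = θ c p := by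
    intro a b c h p
    rw [← hθadd, h]
  have hc : ∀ t : ℝ, 0 ≤ t → ∀ p, Continuous (φ t p) := by
    intro t ht p
    exact hφcont.comp_continuous (f := fun x : X => (t, p, x)) (by fun_prop) (fun _ => ht)
  let K : NNReal → P → Set X := fun t p => φ t (θ (-(t : ℝ)) p) '' U (θ (-(t : ℝ)) p)
  have hKc : ∀ t p, IsCompact (K t p) := fun t p => (hUcpt _).image (hc _ t.2 _)
  have hKne : ∀ t p, (K t p).Nonempty := fun t p => (hUne _).image _
  have hanti : ∀ p, Antitone (fun t => K t p) := by
    intro p s t hst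
    have hst' : (s : ℝ) ≤ t := hst
    rintro _ ⟨x, hx, rfl⟩
    have e1 : θ ((t : ℝ) - s) (θ (-(t : ℝ)) p) = θ (-(s : ℝ)) p := hθθ _ _ _ (by ring) p
    refine ⟨φ ((t : ℝ) - s) (θ (-(t : ℝ)) p) x, ?_, ?_⟩
    · rw [← e1]
      exact hfwd _ (sub_nonneg.2 hst') _ ⟨x, hx, rfl⟩
    · rw [← e1, ← hφcoc _ _ s.coe_nonneg (sub_nonneg.2 hst')]
      congr 1
      ring
  have hω : ∀ p, pullbackOmegaLimit θ φ U p = ⋂ t, K t p := by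
    intro p
    ext x
    simp only [pullbackOmegaLimit, mem_iInter]
    constructor
    · intro h t
      have h1 := h t t.2
      refine closure_minimal ?_ (hKc t p).isClosed h1
      intro y hy
      simp only [mem_iUnion] at hy
      obtain ⟨s, hs, hy⟩ := hy
      have hs' : (t : ℝ) ≤ s := hs
      exact hanti p (show t ≤ ⟨s, t.2.trans hs'⟩ from hs') hy
    · intro h T hT
      apply subset_closure
      simp only [mem_iUnion]
      exact ⟨T, le_refl T, h ⟨T, hT⟩⟩
  have himg : ∀ (t s : NNReal) p, φ t p '' K s p = K (t + s) (θ t p) := by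
    intro t s p
    have e : θ (-((t + s : NNReal) : ℝ)) (θ t p) = θ (-(s : ℝ)) p :=
      hθθ _ _ _ (by push_cast; ring) p
    have e2 : θ (s : ℝ) (θ (-(s : ℝ)) p) = p := by
      rw [hθθ _ _ 0 (by ring), hθ0]
    simp only [K]
    rw [e, image_image]
    apply image_congr
    intro x _
    rw [NNReal.coe_add, hφcoc _ _ t.coe_nonneg s.coe_nonneg, e2]
  have hne : ∀ p, (⋂ t, K t p).Nonempty := fun p =>
    IsCompact.nonempty_iInter_of_directed_nonempty_isCompact_isClosed _
      (hanti p).directed_ge (fun t => hKne t p) (fun t => hKc t p) (fun t => (hKc t p).isClosed)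
  refine ⟨fun p => ?_, ?_, ?_⟩
  · rw [hω]
    exact ⟨hne p, (hKc 0 p).of_isClosed_subset
      (isClosed_iInter fun t => (hKc t p).isClosed) (iInter_subset _ 0)⟩
  · intro t ht p
    lift t to NNReal using ht
    rw [hω, hω]
    apply Subset.antisymm
    · rintro _ ⟨y, hy, rfl⟩
      rw [mem_iInter] at hy ⊢
      intro s
      apply hanti _ (show s ≤ t + s from le_add_self)
      change _ ∈ K (t + s) (θ t p)
      rw [← himg]
      exact ⟨y, hy s, rfl⟩
    · intro z hz
      rw [mem_iInter] at hz
      have hcl : IsClosed (φ t p ⁻¹' {z}) := isClosed_singleton.preimage (hc _ t.2 p)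
      have : (⋂ s, K s p ∩ φ t p ⁻¹' {z}).Nonempty := by
        apply IsCompact.nonempty_iInter_of_directed_nonempty_isCompact_isClosed
        · apply Antitone.directed_ge
          intro a b hab
          exact inter_subset_inter_left _ (hanti p hab)
        · intro s
          have := hz (t + s)
          rw [← himg] at this
          obtain ⟨y, hy, h⟩ := this
          exact ⟨y, hy, h⟩
        · exact fun s => (hKc s p).inter_right hcl
        · exact fun s => (hKc s p).isClosed.inter hcl
      obtain ⟨y, hy⟩ := this
      rw [mem_iInter] at hy
      exact ⟨y, mem_iInter.2 fun s => (hy s).1, (hy 0).2⟩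
  · intro p ε hε
    rw [hω]
    obtain ⟨T, hT⟩ := exists_subset_nhds_of_isCompact' (hanti p).directed_ge
      (fun t => hKc t p) (fun t => (hKc t p).isClosed)
      (U := {x | Metric.infDist x (⋂ t, K t p) < ε}) (by
        intro x hx
        apply (isOpen_lt (continuous_infDist_pt _) continuous_const).mem_nhds
        change Metric.infDist x _ < ε
        rwa [infDist_zero_of_mem hx])
    refine ⟨T, fun t ht x hx => ?_⟩
    exact hT (hanti p (show T ≤ ⟨t, T.2.trans ht⟩ from ht) ⟨x, hx, rfl⟩)
end

section
/- Let θ be a base flow on a compact metric space P and let (φ_λ)_{λ∈ℝ} be a family of cocycle semiflows on a complete metric space X over θ. Fix λ₀ ∈ ℝ and assume condition (H2): for every T > 0 and every compact set B ⊆ X, sup{ d(φ_λ(t,p)x, φ_{λ₀}(t,p)x) : t ∈ [0,T], x ∈ B, p ∈ P } → 0 as λ → λ₀. Let A_{λ₀}(·) be a nonautonomous set with each A_{λ₀}(p) compact, invariant under φ_{λ₀}, which pullback attracts a nonautonomous set U(·); assume 𝕌 = {(p,x) ∈ P × X : x ∈ U(p)} is compact, the closure of 𝔸_{λ₀} = {(p,x)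 : x ∈ A_{λ₀}(p)} is contained in the interior of 𝕌, and additionally that U(·) is forward invariant under φ_{λ₀}. Then the pullback attractors A_λ(·) ⊆ U(·) of φ_λ obtained for λ near λ₀ (compact, invariant under φ_λ, pullback attracting U(·)) converge section-wise to A_{λ₀}(·): for every p ∈ P, H(A_λ(p), A_{λ₀}(p)) → 0 as λ → λ₀. -/
open Set Filter Metric

theorem continuity_of_pullback_attractors_of_forward_invariant_basin
    {P X : Type*} [MetricSpace P] [CompactSpace P] [MetricSpace X] [CompleteSpace X]
    (θ : ℝ → P → P) (φ : ℝ → ℝ → P → X → X) (lam₀ : ℝ)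
    -- θ is a base flow on P
    (hθcont : Continuous fun q : ℝ × P => θ q.1 q.2)
    (hθ0 : ∀ p, θ 0 p = p)
    (hθadd : ∀ t s : ℝ, ∀ p, θ (t + s) p = θ t (θ s p))
    -- each φ_λ is a cocycle semiflow on X over θ
    (hφcont : ∀ lam : ℝ,
      ContinuousOn (fun q : ℝ × P × X => φ lam q.1 q.2.1 q.2.2) {q | 0 ≤ q.1})
    (hφ0 : ∀ lam : ℝ, ∀ p x, φ lam 0 p x = x)
    (hφcoc : ∀ lam : ℝ, ∀ t s : ℝ, 0 ≤ t → 0 ≤ s → ∀ p x,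
      φ lam (t + s) p x = φ lam t (θ s p) (φ lam s p x))
    -- condition (H2)
    (hH2 : ∀ T > (0 : ℝ), ∀ B : Set X, IsCompact B → ∀ ε > (0 : ℝ), ∃ δ > (0 : ℝ),
      ∀ lam : ℝ, |lam - lam₀| < δ → ∀ t ∈ Icc (0 : ℝ) T, ∀ x ∈ B, ∀ p : P,
        dist (φ lam t p x) (φ lam₀ t p x) < ε)
    -- A_{λ₀}: compact, invariant under φ_{λ₀}, pullback attracting U
    (A₀ U : P → Set X)
    (hA₀cpt : ∀ p, IsCompact (A₀ p))
    (hA₀inv : ∀ t : ℝ, 0 ≤ t → ∀ p : P, φ lam₀ t p '' A₀ p = A₀ (θ t p))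
    (hattr₀ : PullbackAttracts θ (φ lam₀) A₀ U)
    -- 𝕌 is compact and a neighborhood of 𝔸_{λ₀}
    (hUcpt : IsCompact {y : P × X | y.2 ∈ U y.1})
    (hnbhd : closure {y : P × X | y.2 ∈ A₀ y.1} ⊆ interior {y : P × X | y.2 ∈ U y.1})
    -- in addition, U is forward invariant under φ_{λ₀}
    (hUfwd : ∀ t : ℝ, 0 ≤ t → ∀ p : P, φ lam₀ t p '' U p ⊆ U (θ t p)) :
    -- any family of pullback attractors of φ_λ inside U, defined for λ near λ₀,
    -- converges section-wise to A₀
    ∀ δ > (0 : ℝ), ∀ A : ℝ → P → Set X,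
      (∀ lam : ℝ, |lam - lam₀| < δ →
        (∀ p, IsCompact (A lam p)) ∧
        (∀ t : ℝ, 0 ≤ t → ∀ p : P, φ lam t p '' A lam p = A lam (θ t p)) ∧
        (∀ p, A lam p ⊆ U p) ∧
        PullbackAttracts θ (φ lam) (A lam) U) →
      ∀ p : P, ∀ ε > (0 : ℝ), ∃ δ' : ℝ, 0 < δ' ∧ δ' ≤ δ ∧
        ∀ lam : ℝ, |lam - lam₀| < δ' → ∀ x ∈ A lam p,
          Metric.infDist x (A₀ p) < ε := by
  intro δ hδ A hA p ε hε
  obtain ⟨T, hT⟩ := hattr₀ p (ε / 2) (half_pos hε)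
  have hS : (0 : ℝ) < max T 1 := lt_of_lt_of_le one_pos (le_max_right _ _)
  have hTS : max T 1 ≥ T := le_max_left _ _
  generalize max T 1 = S at hS hTS
  obtain ⟨η, hη, hη2⟩ := hH2 S hS (Prod.snd '' {y : P × X | y.2 ∈ U y.1})
    (hUcpt.image continuous_snd) (ε / 2) (half_pos hε)
  refine ⟨min δ η, lt_min hδ hη, min_le_left _ _, ?_⟩
  intro lam hlam x hx
  obtain ⟨-, hinv, hsub, -⟩ := hA lam (lt_of_lt_of_le hlam (min_le_left _ _))
  have hp : θ S (θ (-S) p) = p := by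
    rw [← hθadd, add_neg_cancel, hθ0]
  have hx' : x ∈ φ lam S (θ (-S) p) '' A lam (θ (-S) p) := by
    rw [hinv S hS.le, hp]
    exact hx
  obtain ⟨y, hy, rfl⟩ := hx'
  have hyU := hsub _ hy
  have h1 := hT S hTS y hyU
  have h2 := hη2 lam (lt_of_lt_of_le hlam (min_le_right _ _)) S ⟨hS.le, le_rfl⟩ y
    ⟨(θ (-S) p, y), hyU, rfl⟩ (θ (-S) p)
  have h3 := Metric.infDist_le_infDist_add_dist (s := A₀ p)
    (x := φ lam S (θ (-S) p) y) (y := φ lam₀ S (θ (-S) p) y)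
  linarith
end

section
/- Let p : ℝ → ℝ be continuous with 1 ≤ p(t) ≤ 3 for all t ∈ ℝ (as holds for every function in the hull of t ↦ 2 + sin t), and let x : [0,∞) → ℝ be differentiable with x'(t) = −3x(t) + p(t)x(t)³ for all t ≥ 0. If |x(0)| ≤ 1/2, then x(t) → 0 as t → ∞. -/
open Set Filter Real

theorem solutions_starting_small_tend_to_zero
    (p : ℝ → ℝ) (hp_cont : Continuous p)
    (hp_bdd : ∀ t : ℝ, 1 ≤ p t ∧ p t ≤ 3)
    (x : ℝ → ℝ)
    (hx : ∀ t : ℝ, 0 ≤ t → HasDerivAt x (-3 * x t + p t * (x t) ^ 3) t)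
    (hx0 : |x 0| ≤ 1 / 2) :
    Filter.Tendsto x Filter.atTop (nhds 0) := by
  have hV : ∀ t : ℝ, 0 ≤ t →
      HasDerivAt (fun s => x s ^ 2) (2 * x t * (-3 * x t + p t * (x t) ^ 3)) t := by
    intro t ht
    have h := (hx t ht).pow 2
    refine h.congr_deriv ?_
    norm_num
  have hB : ∀ t : ℝ, HasDerivAt (fun s => 1 / 4 * Real.exp (-3 * s))
      (1 / 4 * (Real.exp (-3 * t) * (-3))) t := by
    intro t
    have h : HasDerivAt (fun s : ℝ => -3 * s) (-3) t := by
      simpa using (hasDerivAt_id t).const_mul (-3 : ℝ)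
    exact (h.exp).const_mul _
  have key : ∀ T : ℝ, 0 ≤ T → x T ^ 2 ≤ 1 / 4 * Real.exp (-3 * T) := by
    intro T hT
    refine image_le_of_deriv_right_lt_deriv_boundary (a := 0) (b := T)
      (f := fun s => x s ^ 2) (B := fun s => 1 / 4 * Real.exp (-3 * s))
      (fun t ht => (hV t ht.1).continuousAt.continuousWithinAt)
      (fun t ht => (hV t ht.1).hasDerivWithinAt) ?_ hB ?_ ⟨hT, le_rfl⟩
    · have := abs_le.mp hx0
      simp only [mul_zero, Real.exp_zero]
      nlinarith
    · intro t ht heq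
      have heq' : x t ^ 2 = 1 / 4 * Real.exp (-3 * t) := heq
      have hpos := Real.exp_pos (-3 * t)
      have hle : Real.exp (-3 * t) ≤ 1 := Real.exp_le_one_iff.mpr (by linarith [ht.1])
      have hp := (hp_bdd t).2
      have h1 : 2 * x t * (-3 * x t + p t * (x t) ^ 3)
          = 2 * x t ^ 2 * (-3 + p t * x t ^ 2) := by ring
      have h2 : p t * x t ^ 2 ≤ 3 * (1 / 4) :=
        mul_le_mul hp (by linarith) (sq_nonneg _) (by norm_num)
      have h3 : 0 < x t ^ 2 := by linarith
      rw [h1]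
      nlinarith
  have hlim : Tendsto (fun s : ℝ => 1 / 4 * Real.exp (-3 * s)) atTop (nhds 0) := by
    have h : Tendsto (fun s : ℝ => -3 * s) atTop atBot :=
      tendsto_id.const_mul_atTop_of_neg (by norm_num)
    simpa using (Real.tendsto_exp_atBot.comp h).const_mul (1 / 4 : ℝ)
  have hsq : Tendsto (fun s => x s ^ 2) atTop (nhds 0) :=
    squeeze_zero' (Eventually.of_forall fun s => sq_nonneg _)
      ((eventually_ge_atTop 0).mono key) hlim
  have hs := hsq.sqrt
  simp only [Real.sqrt_sq_eq_abs, Real.sqrt_zero] at hs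
  exact (tendsto_zero_iff_abs_tendsto_zero _).mpr hs
end

section
/- Let p : ℝ → ℝ be continuous with 1 ≤ p(t) ≤ 3 for all t ∈ ℝ (as holds for every function in the hull of t ↦ 2 + sin t), let T > 0, and let x : [0,T] → ℝ be differentiable with x'(t) = −3x(t) + p(t)x(t)³ for all t ∈ [0,T]. If |x(0)| ≥ 2, then x(t)² ≥ e^{2t} x(0)² for all t ∈ [0,T]; in particular |x(t)| ≥ 2 on [0,T] and 0 does not attract such solutions, so 0 is only a local pullback attractor for this equation. -/
open Set Filter Real

theorem solutions_starting_large_grow_exponentially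
    (p : ℝ → ℝ) (hp_cont : Continuous p)
    (hp_bdd : ∀ t : ℝ, 1 ≤ p t ∧ p t ≤ 3)
    (T : ℝ) (hT : 0 < T)
    (x : ℝ → ℝ)
    (hx : ∀ t ∈ Set.Icc (0 : ℝ) T, HasDerivAt x (-3 * x t + p t * (x t) ^ 3) t)
    (hx0 : 2 ≤ |x 0|) :
    ∀ t ∈ Set.Icc (0 : ℝ) T,
      Real.exp (2 * t) * (x 0) ^ 2 ≤ (x t) ^ 2 ∧ 2 ≤ |x t| := by
  have h0 : 4 ≤ (x 0) ^ 2 := by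
    rw [← sq_abs]; nlinarith
  have hV : ∀ t ∈ Set.Icc (0 : ℝ) T, HasDerivAt (fun s => (x s) ^ 2)
      (-6 * (x t) ^ 2 + 2 * p t * ((x t) ^ 2) ^ 2) t := by
    intro t ht
    refine HasDerivAt.congr_deriv ((hx t ht).pow 2) ?_
    push_cast
    ring
  have h4 : ∀ t ∈ Set.Icc (0 : ℝ) T, (4 : ℝ) ≤ (x t) ^ 2 := by
    intro t ht
    refine image_le_of_deriv_right_lt_deriv_boundary' (f := fun _ => (4 : ℝ)) (f' := fun _ => 0)
      (B := fun s => (x s) ^ 2)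
      (B' := fun t => -6 * (x t) ^ 2 + 2 * p t * ((x t) ^ 2) ^ 2)
      continuousOn_const (fun s _ => hasDerivWithinAt_const _ _ _) h0
      (fun s hs => (hV s hs).continuousAt.continuousWithinAt)
      (fun s hs => (hV s (Ico_subset_Icc_self hs)).hasDerivWithinAt) ?_ ht
    intro s _ he
    have he' : (x s) ^ 2 = 4 := he.symm
    have := (hp_bdd s).1
    simp only [he']
    linarith
  have hW : ∀ t ∈ Set.Icc (0 : ℝ) T, HasDerivAt (fun s => Real.exp (-2 * s) * (x s) ^ 2)
      (Real.exp (-2 * t) * (-8 * (x t) ^ 2 + 2 * p t * ((x t) ^ 2) ^ 2)) t := by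
    intro t ht
    have h1 : HasDerivAt (fun s : ℝ => Real.exp (-2 * s)) (Real.exp (-2 * t) * (-2 * 1)) t :=
      ((hasDerivAt_id t).const_mul (-2)).exp
    refine HasDerivAt.congr_deriv (h1.mul (hV t ht)) ?_
    ring
  have hmono : MonotoneOn (fun s => Real.exp (-2 * s) * (x s) ^ 2) (Set.Icc (0 : ℝ) T) := by
    refine monotoneOn_of_deriv_nonneg (convex_Icc _ _)
      (fun s hs => (hW s hs).continuousAt.continuousWithinAt)
      (fun s hs => (hW s (interior_subset hs)).differentiableAt.differentiableWithinAt) ?_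
    intro s hs
    have hs' := interior_subset hs
    rw [(hW s hs').deriv]
    have a := h4 s hs'
    have b := (hp_bdd s).1
    refine mul_nonneg (Real.exp_pos _).le ?_
    nlinarith [mul_nonneg (sub_nonneg.2 b) (sq_nonneg ((x s) ^ 2))]
  intro t ht
  constructor
  · have h := hmono (left_mem_Icc.2 hT.le) ht ht.1
    simp only [mul_zero, Real.exp_zero, one_mul] at h
    calc Real.exp (2 * t) * (x 0) ^ 2
        ≤ Real.exp (2 * t) * (Real.exp (-2 * t) * (x t) ^ 2) :=
          mul_le_mul_of_nonneg_left h (Real.exp_pos _).le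
      _ = (x t) ^ 2 := by
          rw [← mul_assoc, ← Real.exp_add]
          simp
  · have h := h4 t ht
    rw [← sq_abs] at h
    nlinarith [abs_nonneg (x t)]
end
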